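/- Let G be a bipartite graph on at least 4 vertices that admits an odd proper ear decomposition (P_0, ..., P_f). Then for each i, the subgraph G_i consisting of the union of P_0, ..., P_i is balanced and DM-irreducible; in particular G itself is balanced and DM-irreducible. -/

import Mathlib

open Sum

/-- The simple graph on `α ⊕ β` determined by an edge set `E ⊆ α × β`. -/
def sg {α β : Type*} (E : Set (α × β)) : SimpleGraph (α ⊕ β) :=
  SimpleGraph.fromRel (fun u v => ∃ a b, u = inl a ∧ v = inr b ∧ (a, b) ∈ E)

/-- An odd proper ear decomposition of a graph `G`: a cycle `P₀` of length at least 4,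
followed by ears `P₁, …, P_f` (here indexed by `Fin f`), each an odd-length path whose
two (distinct) endpoints lie in the union of the previous ears and whose inner vertices
are new; the edge sets of the ears are pairwise disjoint and partition the edge set of `G`,
and every vertex of `G` lies on some ear. -/
structure OddProperEarDecomp {V : Type*} (G : SimpleGraph V) where
  f : ℕ
  v0 : V
  P0 : G.Walk v0 v0
  hP0cyc : P0.IsCycle
  hP0len : 4 ≤ P0.length
  src : Fin f → V
  tgt : Fin f → V
  ear : (i : Fin f) → G.Walk (src i) (tgt i)
  hpath : ∀ i, (ear i).IsPath
  hodd : ∀ i, Odd (ear i).length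
  hne : ∀ i, src i ≠ tgt i
  hsrc : ∀ i : Fin f, src i ∈ P0.support ∨ ∃ j : Fin f, j < i ∧ src i ∈ (ear j).support
  htgt : ∀ i : Fin f, tgt i ∈ P0.support ∨ ∃ j : Fin f, j < i ∧ tgt i ∈ (ear j).support
  hinner : ∀ i : Fin f, ∀ v ∈ (ear i).support, v ≠ src i → v ≠ tgt i →
    ¬ (v ∈ P0.support ∨ ∃ j : Fin f, j < i ∧ v ∈ (ear j).support)
  hcover : ∀ e ∈ G.edgeSet, e ∈ P0.edges ∨ ∃ i : Fin f, e ∈ (ear i).edges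
  hdisj0 : ∀ i : Fin f, ∀ e ∈ (ear i).edges, e ∉ P0.edges
  hdisj : ∀ i j : Fin f, i ≠ j → ∀ e ∈ (ear i).edges, e ∉ (ear j).edges
  hspan : ∀ v : V, v ∈ P0.support ∨ ∃ i : Fin f, v ∈ (ear i).support

/-- Arc relation of the auxiliary digraph. -/
def Step {α β : Type*} (E M : Set (α × β)) : (α ⊕ β) → (α ⊕ β) → Prop
  | inl a, inr b => (a, b) ∈ E
  | inr b, inl a => (a, b) ∈ M
  | _, _ => False

def StronglyConnected {V : Type*} (R : V → V → Prop) : Prop :=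
  ∀ u v : V, Relation.ReflTransGen R u v

def IsPerfectMatching {α β : Type*} (E M : Set (α × β)) : Prop :=
  M ⊆ E ∧ (∀ a : α, ∃! b : β, (a, b) ∈ M) ∧ (∀ b : β, ∃! a : α, (a, b) ∈ M)

def DMIrreducible {α β : Type*} (E : Set (α × β)) : Prop :=
  ∃ M, IsPerfectMatching E M ∧ StronglyConnected (Step E M)

/-- Vertex set of the prefix subgraph `G_i` (the union of `P₀` and the first `i` ears). -/
def prevSet {α β : Type*} {E : Set (α × β)} (D : OddProperEarDecomp (sg E)) (i : ℕ) :
    Set (α ⊕ β) :=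
  {v | v ∈ D.P0.support ∨ ∃ j : Fin D.f, (j : ℕ) < i ∧ v ∈ (D.ear j).support}

/-- Edge set of the prefix subgraph `G_i` (as a set of bipartite edges). -/
def prevEdges {α β : Type*} {E : Set (α × β)} (D : OddProperEarDecomp (sg E)) (i : ℕ) :
    Set (α × β) :=
  {p | s(inl p.1, inr p.2) ∈ D.P0.edges ∨
    ∃ j : Fin D.f, (j : ℕ) < i ∧ s(inl p.1, inr p.2) ∈ (D.ear j).edges}

/-- `M` is a perfect matching of the subgraph induced on the vertex set `S`. -/
def PMOn {α β : Type*} (S : Set (α ⊕ β)) (M : Set (α × β)) : Prop :=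
  (∀ p ∈ M, inl p.1 ∈ S ∧ inr p.2 ∈ S) ∧
  (∀ a : α, inl a ∈ S → ∃! b : β, (a, b) ∈ M) ∧
  (∀ b : β, inr b ∈ S → ∃! a : α, (a, b) ∈ M)

/-- The subgraph with vertex set `S` and edge set `F` is DM-irreducible. -/
def DMIrrOn {α β : Type*} (S : Set (α ⊕ β)) (F : Set (α × β)) : Prop :=
  ∃ M, M ⊆ F ∧ PMOn S M ∧ ∀ u ∈ S, ∀ v ∈ S, Relation.ReflTransGen (Step F M) u v

/-- The subgraph on the vertex set `S` is balanced. -/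
def BalancedOn {α β : Type*} (S : Set (α ⊕ β)) : Prop :=
  {a : α | inl a ∈ S}.ncard = {b : β | inr b ∈ S}.ncard

theorem sg_adj_cases {α β : Type*} {E : Set (α × β)} {u v : α ⊕ β} (h : (sg E).Adj u v) :
    (∃ a b, u = inl a ∧ v = inr b) ∨ (∃ a b, u = inr b ∧ v = inl a) := by
  unfold sg at h
  rw [SimpleGraph.fromRel_adj] at h
  obtain ⟨_, ⟨a, b, rfl, rfl, _⟩ | ⟨a, b, rfl, rfl, _⟩⟩ := h
  · exact Or.inl ⟨a, b, rfl, rfl⟩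
  · exact Or.inr ⟨a, b, rfl, rfl⟩

theorem sg_parity {α β : Type*} {E : Set (α × β)} {u v : α ⊕ β} (p : (sg E).Walk u v) :
    (Odd p.length ↔ u.isLeft ≠ v.isLeft) := by
  induction p with
  | nil => simp
  | cons h p ih =>
    rw [SimpleGraph.Walk.length_cons, Nat.odd_add_one, ih]
    rcases sg_adj_cases h with ⟨a, b, rfl, rfl⟩ | ⟨a, b, rfl, rfl⟩ <;> simp

theorem reach_of_darts {V : Type*} {G : SimpleGraph V} {R : V → V → Prop} {u v : V}
    (p : G.Walk u v) (h : ∀ d ∈ p.darts, R d.fst d.snd) :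
    ∀ w ∈ p.support, Relation.ReflTransGen R u w ∧ Relation.ReflTransGen R w v := by
  induction p with
  | nil => intro w hw; simp at hw; subst hw; exact ⟨.refl, .refl⟩
  | cons hadj p ih =>
    have ih' := ih (fun d hd => h d (by simp [hd]))
    have h1 := h ⟨(_, _), hadj⟩ (by simp)
    intro w hw
    rw [SimpleGraph.Walk.support_cons, List.mem_cons] at hw
    rcases hw with rfl | hw
    · exact ⟨.refl, .head h1 (ih' _ p.start_mem_support).2⟩
    · exact ⟨.head h1 (ih' _ hw).1, (ih' _ hw).2⟩

theorem ear_step_lr {α β : Type*} {E : Set (α × β)} {S : Set (α ⊕ β)} {F : Set (α × β)}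
    (hD : DMIrrOn S F) {a : α} {b : β} (p : (sg E).Walk (inl a) (inr b)) (hp : p.IsPath)
    (ha : inl a ∈ S) (hb : inr b ∈ S)
    (hin : ∀ w ∈ p.support, w ≠ inl a → w ≠ inr b → w ∉ S) :
    DMIrrOn (S ∪ {w | w ∈ p.support}) (F ∪ {q | s(inl q.1, inr q.2) ∈ p.edges}) := by
  obtain ⟨M, hMF, ⟨hMS, hMa, hMb⟩, hsc⟩ := hD
  have hnd : p.support.Nodup := hp.support_nodup
  have e1 := p.cons_map_snd_darts
  have e2 := p.map_fst_darts_append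
  have n1 : (inl a :: List.map (fun d : (sg E).Dart => d.snd) p.darts).Nodup := by
    rw [← e1] at hnd; exact hnd
  have n2 : (List.map (fun d : (sg E).Dart => d.fst) p.darts ++ [inr b]).Nodup := by
    rw [← e2] at hnd; exact hnd
  have n1' : (List.map (fun d : (sg E).Dart => d.snd) p.darts).Nodup := (List.nodup_cons.1 n1).2
  have n2' : (List.map (fun d : (sg E).Dart => d.fst) p.darts).Nodup := n2.of_append_left
  have nosnd : ∀ d ∈ p.darts, d.snd ≠ inl a := by
    intro d hd h
    exact (List.nodup_cons.1 n1).1 (List.mem_map.2 ⟨d, hd, h⟩)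
  have nofst : ∀ d ∈ p.darts, d.fst ≠ inr b := by
    intro d hd h
    have := (List.nodup_append.1 n2).2.2 _ (List.mem_map.2 ⟨d, hd, rfl⟩) (inr b) (by simp)
    exact this h
  let N : Set (α × β) := {q | ∃ d ∈ p.darts, d.fst = inr q.2 ∧ d.snd = inl q.1}
  have hNsup : ∀ q ∈ N, inl q.1 ∈ p.support ∧ inr q.2 ∈ p.support := by
    rintro q ⟨d, hd, h1, h2⟩
    exact ⟨h2 ▸ p.dart_snd_mem_support_of_mem_darts hd,
      h1 ▸ p.dart_fst_mem_support_of_mem_darts hd⟩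
  have hNS : ∀ q ∈ N, inl q.1 ∉ S ∧ inr q.2 ∉ S := by
    intro q hq
    have h3 := hNsup q hq
    obtain ⟨d, hd, h1, h2⟩ := hq
    exact ⟨hin _ h3.1 (h2 ▸ nosnd d hd) (by simp), hin _ h3.2 (by simp) (h1 ▸ nofst d hd)⟩
  have hstep : ∀ d ∈ p.darts,
      Step (F ∪ {q | s(inl q.1, inr q.2) ∈ p.edges}) (M ∪ N) d.fst d.snd := by
    intro d hd
    have hde : s(d.fst, d.snd) ∈ p.edges := List.mem_map.2 ⟨d, hd, rfl⟩
    rcases sg_adj_cases d.adj with ⟨x, y, h1, h2⟩ | ⟨x, y, h1, h2⟩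
    · rw [h1, h2] at hde ⊢
      exact Or.inr hde
    · rw [h1, h2]
      exact Or.inr ⟨d, hd, h1, h2⟩
  have hmono : ∀ x y, Relation.ReflTransGen (Step F M) x y → Relation.ReflTransGen
      (Step (F ∪ {q | s(inl q.1, inr q.2) ∈ p.edges}) (M ∪ N)) x y := by
    intro x y h
    refine Relation.ReflTransGen.mono ?_ _ _ h
    rintro (x | x) (y | y) h
    · exact h
    · exact Or.inl h
    · exact Or.inl h
    · exact h
  have hr := reach_of_darts p hstep
  refine ⟨M ∪ N, ?_, ⟨?_, ?_, ?_⟩, ?_⟩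
  · rintro q (hq | ⟨d, hd, h1, h2⟩)
    · exact Or.inl (hMF hq)
    · have hde : s(d.fst, d.snd) ∈ p.edges := List.mem_map.2 ⟨d, hd, rfl⟩
      rw [h1, h2, Sym2.eq_swap] at hde
      exact Or.inr hde
  · rintro q (hq | hq)
    · exact ⟨Or.inl (hMS q hq).1, Or.inl (hMS q hq).2⟩
    · exact ⟨Or.inr (hNsup q hq).1, Or.inr (hNsup q hq).2⟩
  · intro x hx
    by_cases hxS : inl x ∈ S
    · obtain ⟨y, hy, hu⟩ := hMa x hxS
      refine ⟨y, Or.inl hy, ?_⟩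
      rintro z (hz | hz)
      · exact hu z hz
      · exact absurd hxS (hNS _ hz).1
    · have hx' : inl x ∈ p.support := hx.resolve_left hxS
      have hx2 := hx'
      rw [← e1, List.mem_cons] at hx2
      obtain ⟨d, hd, h2⟩ := List.mem_map.1 (hx2.resolve_left (fun h => hxS (h ▸ ha)))
      have hfst : ∃ y, d.fst = inr y := by
        rcases sg_adj_cases d.adj with ⟨_, _, _, h⟩ | ⟨_, y, h, _⟩
        · rw [h] at h2; simp at h2
        · exact ⟨y, h⟩
      obtain ⟨y, hy⟩ := hfst
      refine ⟨y, Or.inr ⟨d, hd, hy, h2⟩, ?_⟩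
      rintro z (hz | ⟨d', hd', h1', h2'⟩)
      · exact absurd (hMS _ hz).1 hxS
      · have : d' = d := List.inj_on_of_nodup_map n1' hd' hd (h2'.trans h2.symm)
        subst this
        exact Sum.inr_injective (h1'.symm.trans hy)
  · intro x hx
    by_cases hxS : inr x ∈ S
    · obtain ⟨y, hy, hu⟩ := hMb x hxS
      refine ⟨y, Or.inl hy, ?_⟩
      rintro z (hz | hz)
      · exact hu z hz
      · exact absurd hxS (hNS _ hz).2
    · have hx' : inr x ∈ p.support := hx.resolve_left hxS
      have hx2 := hx'
      rw [← e2, List.mem_append] at hx2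
      obtain ⟨d, hd, h2⟩ := List.mem_map.1 (hx2.resolve_right
        (fun h => hxS ((List.mem_singleton.1 h) ▸ hb)))
      have hsnd : ∃ y, d.snd = inl y := by
        rcases sg_adj_cases d.adj with ⟨_, _, h, _⟩ | ⟨y, _, _, h⟩
        · rw [h] at h2; simp at h2
        · exact ⟨y, h⟩
      obtain ⟨y, hy⟩ := hsnd
      refine ⟨y, Or.inr ⟨d, hd, h2, hy⟩, ?_⟩
      rintro z (hz | ⟨d', hd', h1', h2'⟩)
      · exact absurd (hMS _ hz).2 hxS
      · have : d' = d := List.inj_on_of_nodup_map n2' hd' hd (h1'.trans h2.symm)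
        subst this
        exact Sum.inl_injective (h2'.symm.trans hy)
  · have key1 : ∀ w ∈ S ∪ {w | w ∈ p.support}, Relation.ReflTransGen
        (Step (F ∪ {q | s(inl q.1, inr q.2) ∈ p.edges}) (M ∪ N)) w (inr b) := by
      rintro w (hw | hw)
      · exact hmono _ _ (hsc _ hw _ hb)
      · exact (hr w hw).2
    have key2 : ∀ w ∈ S ∪ {w | w ∈ p.support}, Relation.ReflTransGen
        (Step (F ∪ {q | s(inl q.1, inr q.2) ∈ p.edges}) (M ∪ N)) (inl a) w := by
      rintro w (hw | hw)
      · exact hmono _ _ (hsc _ ha _ hw)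
      · exact (hr w hw).1
    intro x hx y hy
    exact ((key1 x hx).trans (hmono _ _ (hsc _ hb _ ha))).trans (key2 y hy)

theorem ear_step {α β : Type*} {E : Set (α × β)} {S : Set (α ⊕ β)} {F : Set (α × β)}
    (hD : DMIrrOn S F) {u v : α ⊕ β} (p : (sg E).Walk u v) (hp : p.IsPath)
    (hodd : Odd p.length) (ha : u ∈ S) (hb : v ∈ S)
    (hin : ∀ w ∈ p.support, w ≠ u → w ≠ v → w ∉ S) :
    DMIrrOn (S ∪ {w | w ∈ p.support}) (F ∪ {q | s(inl q.1, inr q.2) ∈ p.edges}) := by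
  have hpar := (sg_parity p).1 hodd
  rcases u with a | b <;> rcases v with a' | b'
  · simp at hpar
  · exact ear_step_lr hD p hp ha hb hin
  · have := ear_step_lr hD p.reverse hp.reverse hb ha
      (fun w hw h1 h2 => hin w (by simpa using hw) h2 h1)
    simpa using this
  · simp at hpar

theorem edge_base {α β : Type*} (a : α) (b : β) :
    DMIrrOn ({inl a, inr b} : Set (α ⊕ β)) {(a, b)} := by
  refine ⟨{(a, b)}, subset_rfl, ⟨?_, ?_, ?_⟩, ?_⟩
  · rintro q rfl; simp
  · intro x hx
    simp at hx
    subst hx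
    exact ⟨b, rfl, fun y hy => by simpa using hy⟩
  · intro x hx
    simp at hx
    subst hx
    exact ⟨a, rfl, fun y hy => by simpa using hy⟩
  · have s1 : Step ({(a, b)} : Set (α × β)) {(a, b)} (inl a) (inr b) := rfl
    have s2 : Step ({(a, b)} : Set (α × β)) {(a, b)} (inr b) (inl a) := rfl
    rintro u (rfl | rfl) v (rfl | rfl)
    · exact .refl
    · exact .single s1
    · exact .single s2
    · exact .refl

theorem edge_base' {α β : Type*} {E : Set (α × β)} {u v : α ⊕ β} (h : (sg E).Adj u v) :
    DMIrrOn ({u, v} : Set (α ⊕ β)) {q | s(inl q.1, inr q.2) = s(u, v)} := by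
  rcases sg_adj_cases h with ⟨a, b, rfl, rfl⟩ | ⟨a, b, rfl, rfl⟩
  · convert edge_base a b using 1
    ext ⟨x, y⟩; simp
  · convert edge_base a b using 1
    · exact Set.pair_comm _ _
    · ext ⟨x, y⟩; simp

theorem cycle_base {α β : Type*} {E : Set (α × β)} {u : α ⊕ β} (p : (sg E).Walk u u)
    (hp : p.IsCycle) :
    DMIrrOn {w | w ∈ p.support} {q : α × β | s(inl q.1, inr q.2) ∈ p.edges} := by
  cases p with
  | nil => exact absurd rfl hp.ne_nil
  | @cons _ v _ h p =>
    have hpath := (SimpleGraph.Walk.cons_isCycle_iff p h).1 hp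
    have hodd : Odd p.length := by
      rw [sg_parity]
      rcases sg_adj_cases h with ⟨a, b, rfl, rfl⟩ | ⟨a, b, rfl, rfl⟩ <;> simp
    have := ear_step (edge_base' h) p hpath.1 hodd (by simp) (by simp)
      (fun w _ h1 h2 => by simp [h1, h2])
    convert this using 1
    · ext w
      have h1 := p.start_mem_support
      have h2 := p.end_mem_support
      simp only [SimpleGraph.Walk.support_cons, List.mem_cons, Set.mem_ofPred_eq, Set.mem_union,
        Set.mem_insert_iff, Set.mem_singleton_iff]
      constructor
      · tauto
      · rintro ((rfl | rfl) | h) <;> tauto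
    · ext q
      simp only [SimpleGraph.Walk.edges_cons, List.mem_cons, Set.mem_ofPred_eq, Set.mem_union]

theorem balanced_of {α β : Type*} {S : Set (α ⊕ β)} {F : Set (α × β)} (h : DMIrrOn S F) :
    BalancedOn S := by
  obtain ⟨M, -, ⟨hS, ha, hb⟩, -⟩ := h
  unfold BalancedOn
  choose f hf hu using ha
  refine Set.ncard_congr f (fun a h => (hS _ (hf a h)).2) ?_ ?_
  · intro a a' h h' he
    have h1 := hf a h
    have h2 := hf a' h'
    simp only at h1 h2
    rw [← he] at h2
    exact (hb _ (hS _ h1).2).unique h1 h2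
  · intro b h
    obtain ⟨a, hab, -⟩ := hb b h
    exact ⟨a, (hS _ hab).1, (hu a (hS _ hab).1 b hab).symm⟩

theorem stmt14 {α β : Type*} [Fintype α] [Fintype β]
    (E : Set (α × β)) (hV : 4 ≤ Fintype.card α + Fintype.card β)
    (D : OddProperEarDecomp (sg E)) :
    ∀ i : ℕ, i ≤ D.f →
      BalancedOn (α := α) (β := β) (prevSet D i) ∧ DMIrrOn (prevSet D i) (prevEdges D i) := by
  have main : ∀ i : ℕ, i ≤ D.f → DMIrrOn (prevSet D i) (prevEdges D i) := by
    intro i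
    induction i with
    | zero =>
      intro _
      convert cycle_base D.P0 D.hP0cyc using 1
      · ext w; simp [prevSet]
      · ext w; simp [prevEdges]
    | succ i ih =>
      intro hi
      have hlt : i < D.f := hi
      let k : Fin D.f := ⟨i, hlt⟩
      have := ear_step (ih hlt.le) (D.ear k) (D.hpath k) (D.hodd k) (D.hsrc k) (D.htgt k)
        (D.hinner k)
      have key : ∀ Q : Fin D.f → Prop, (∃ j : Fin D.f, (j : ℕ) < i + 1 ∧ Q j) ↔
          (∃ j : Fin D.f, (j : ℕ) < i ∧ Q j) ∨ Q k := by
        intro Q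
        constructor
        · rintro ⟨j, hj, hQ⟩
          rcases Nat.lt_succ_iff_lt_or_eq.1 hj with h | h
          · exact Or.inl ⟨j, h, hQ⟩
          · have : j = k := Fin.ext h
            exact Or.inr (this ▸ hQ)
        · rintro (⟨j, hj, hQ⟩ | hQ)
          · exact ⟨j, by omega, hQ⟩
          · exact ⟨k, Nat.lt_succ_self i, hQ⟩
      convert this using 1
      · ext w
        simp only [prevSet, Set.mem_ofPred_eq, Set.mem_union, key, or_assoc]
      · ext w
        simp only [prevEdges, Set.mem_ofPred_eq, Set.mem_union, key, or_assoc]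
  intro i hi
  exact ⟨balanced_of (main i hi), main i hi⟩
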